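/- For every vertex u of Γ (in particular for u = x): the centralizer C_{G_u}(Z_u) is not transitive on Γ(u), and Q_u is a Sylow 2-subgroup of C_{G_u}(Z_u). -/

import Mathlib

open MulAction Pointwise

/-- `V`, the `n`-dimensional vector space over the field with 3 elements. -/
abbrev Vec (n : ℕ) := Fin n → ZMod 3

/-- The translation subgroup `V` of `Perm (Vec n)`. -/
def TransGrp (n : ℕ) : Subgroup (Equiv.Perm (Vec n)) :=
  Subgroup.closure {f : Equiv.Perm (Vec n) | ∃ w, ∀ v, f v = v + w}

/-- The Frobenius group `L = V ⋊ C₂` of order `2·3^n`, acting on `V = Vec n`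
by `v ↦ ε·v + w` with `ε = ±1`: it is generated by the translations and negation. -/
def Lgrp (n : ℕ) : Subgroup (Equiv.Perm (Vec n)) :=
  Subgroup.closure ({f : Equiv.Perm (Vec n) | ∃ w, ∀ v, f v = v + w} ∪ {Equiv.neg (Vec n)})

/-- The pointwise stabilizer `G_u^{[s]}` in `G` of the ball of radius `s` around `u`. -/
def ballStab {α : Type*} (Γ : SimpleGraph α) (G : Type*) [Group G] [MulAction G α]
    (u : α) (s : ℕ) : Subgroup G :=
  ⨅ w ∈ {w : α | Γ.dist u w ≤ s}, stabilizer G w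

/-- `Z_{uw} = Ω₁(Z(G_u ∩ G_w))`, the subgroup generated by the elements of order at most 2
of the centre of the arc stabilizer `G_u ∩ G_w`. -/
def Zuw {α : Type*} (G : Type*) [Group G] [MulAction G α] (u w : α) : Subgroup G :=
  Subgroup.closure {g : G |
    g ∈ (stabilizer G u ⊓ stabilizer G w) ⊓
        Subgroup.centralizer ((stabilizer G u ⊓ stabilizer G w : Subgroup G) : Set G) ∧ g ^ 2 = 1}

/-- `Z_u = ⟨Z_{uw}^{G_u}⟩`, the normal closure in `G_u` of the subgroups `Z_{uw}`,
for `w` a neighbour of `u` (independent of the choice of `w` by arc-transitivity). -/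
def Zsub {α : Type*} (Γ : SimpleGraph α) (G : Type*) [Group G] [MulAction G α]
    (u : α) : Subgroup G :=
  Subgroup.closure {k : G | ∃ h ∈ stabilizer G u, ∃ w ∈ Γ.neighborSet u,
    ∃ g ∈ Zuw G u w, k = h * g * h⁻¹}

/-- The critical distance `b = min { d(u,v) : Z_u ≰ G_v^{[1]} }`. -/
noncomputable def critDist {α : Type*} (Γ : SimpleGraph α) (G : Type*) [Group G]
    [MulAction G α] : ℕ :=
  sInf {d : ℕ | ∃ u v : α, Γ.dist u v = d ∧ ¬ Zsub Γ G u ≤ ballStab Γ G v 1}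

/-- `(u,v)` is a critical pair: `d(u,v) = b` and `Z_u ≰ G_v^{[1]}`. -/
def critPair {α : Type*} (Γ : SimpleGraph α) (G : Type*) [Group G] [MulAction G α]
    (u v : α) : Prop :=
  Γ.dist u v = critDist Γ G ∧ ¬ Zsub Γ G u ≤ ballStab Γ G v 1

/-- `(Γ, G)` is locally `L`: for each vertex `u` there is a bijection
`φ : Γ(u) ≃ V` conjugating the permutation group induced by `G_u` on `Γ(u)`
to exactly the permutation group `L` acting on `V`. -/
def LocallyL {α : Type*} (n : ℕ) (Γ : SimpleGraph α) (G : Type*) [Group G]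
    [MulAction G α] : Prop :=
  ∀ u : α, ∃ φ : Γ.neighborSet u ≃ Vec n,
    (∀ g ∈ stabilizer G u, ∃ l ∈ Lgrp n, ∀ z : Γ.neighborSet u,
      ∃ hz : (g • (z : α)) ∈ Γ.neighborSet u, φ ⟨g • (z : α), hz⟩ = l (φ z)) ∧
    (∀ l ∈ Lgrp n, ∃ g ∈ stabilizer G u, ∀ z : Γ.neighborSet u,
      ∃ hz : (g • (z : α)) ∈ Γ.neighborSet u, φ ⟨g • (z : α), hz⟩ = l (φ z))

/-- Elements of `Lgrp n` are the maps `v ↦ v + w` and `v ↦ -v + w`. -/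
theorem Lgrp_apply {n : ℕ} {l : Equiv.Perm (Vec n)} (hl : l ∈ Lgrp n) :
    ∃ w, (∀ v, l v = v + w) ∨ (∀ v, l v = -v + w) := by
  induction hl using Subgroup.closure_induction with
  | mem f hf =>
    rcases hf with ⟨w, hw⟩ | hf
    · exact ⟨w, .inl hw⟩
    · refine ⟨0, .inr fun v => ?_⟩
      rw [Set.mem_singleton_iff.1 hf]
      simp
  | one => exact ⟨0, .inl fun v => by simp⟩
  | mul f g _ _ hf hg =>
    obtain ⟨a, ha | ha⟩ := hf <;> obtain ⟨b, hb | hb⟩ := hg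
    · exact ⟨b + a, .inl fun v => by simp only [Equiv.Perm.mul_apply, ha, hb]; abel⟩
    · exact ⟨b + a, .inr fun v => by simp only [Equiv.Perm.mul_apply, ha, hb]; abel⟩
    · exact ⟨-b + a, .inr fun v => by simp only [Equiv.Perm.mul_apply, ha, hb]; abel⟩
    · exact ⟨-b + a, .inl fun v => by simp only [Equiv.Perm.mul_apply, ha, hb]; abel⟩
  | inv f _ hf =>
    obtain ⟨a, ha | ha⟩ := hf
    · exact ⟨-a, .inl fun v => by rw [Equiv.Perm.inv_eq_iff_eq, ha]; abel⟩
    · exact ⟨a, .inr fun v => by rw [Equiv.Perm.inv_eq_iff_eq, ha]; abel⟩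

theorem addRight_mem_Lgrp {n : ℕ} (w : Vec n) : Equiv.addRight w ∈ Lgrp n :=
  Subgroup.subset_closure (.inl ⟨w, fun _ => rfl⟩)

theorem neg_mem_Lgrp (n : ℕ) : Equiv.neg (Vec n) ∈ Lgrp n :=
  Subgroup.subset_closure (.inr rfl)

theorem Vec.add_add_self {n : ℕ} (v : Vec n) : v + v + v = 0 := by
  funext i
  simp only [Pi.add_apply, Pi.zero_apply]
  generalize v i = a
  revert a
  decide

theorem SimpleGraph.Connected.forall_of_adj {α : Type*} {Γ : SimpleGraph α}
    (hconn : Γ.Connected) {P : α → Prop} (hP : ∀ a b, Γ.Adj a b → P a → P b)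
    {u : α} (hu : P u) (v : α) : P v := by
  obtain ⟨p⟩ := hconn.preconnected u v
  induction p with
  | nil => exact hu
  | cons h _ ih => exact ih (hP _ _ h hu)

section Local

variable {α : Type*} {n : ℕ} {Γ : SimpleGraph α} {G : Type*} [Group G] [MulAction G α]

theorem mem_ballStab_one (hconn : Γ.Connected) {u : α} {g : G} :
    g ∈ ballStab Γ G u 1 ↔ g • u = u ∧ ∀ w, Γ.Adj u w → g • w = w := by
  simp only [ballStab, Subgroup.mem_iInf, Set.mem_ofPred_eq, mem_stabilizer_iff]
  refine ⟨fun h => ⟨h u (by simp), fun w hw => h w (SimpleGraph.dist_eq_one_iff_adj.2 hw).le⟩,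
    fun ⟨h0, h1⟩ w hw => ?_⟩
  rcases Nat.le_one_iff_eq_zero_or_eq_one.1 hw with hd | hd
  · rwa [← (hconn.dist_eq_zero_iff).1 hd]
  · exact h1 w (SimpleGraph.dist_eq_one_iff_adj.1 hd)

theorem LocallyL.exists_adj (hloc : LocallyL n Γ G) (u : α) : ∃ w, Γ.Adj u w := by
  obtain ⟨φ, -, -⟩ := hloc u
  exact ⟨φ.symm 0, (φ.symm 0).2⟩

/-- Under a suitable identification of the neighbours of `u` with `V`, every element fixing `u`
acts as `v ↦ v + w` or `v ↦ -v + w`, and all translations and negation are induced. -/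
theorem LocallyL.exists_affine_action (hloc : LocallyL n Γ G) (u : α) :
    ∃ φ : Γ.neighborSet u ≃ Vec n,
      (∀ w : Vec n, ∃ t ∈ stabilizer G u, ∀ z : Γ.neighborSet u,
        t • (z : α) = φ.symm (φ z + w)) ∧
      (∃ t ∈ stabilizer G u, ∀ z : Γ.neighborSet u, t • (z : α) = φ.symm (-φ z)) ∧
      ∀ g ∈ stabilizer G u, ∃ w : Vec n,
        (∀ z : Γ.neighborSet u, g • (z : α) = φ.symm (φ z + w)) ∨
        (∀ z : Γ.neighborSet u, g • (z : α) = φ.symm (-φ z + w)) := by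
  obtain ⟨φ, h1, h2⟩ := hloc u
  refine ⟨φ, fun w => ?_, ?_, fun g hg => ?_⟩
  · obtain ⟨t, ht, h⟩ := h2 _ (addRight_mem_Lgrp w)
    refine ⟨t, ht, fun z => ?_⟩
    obtain ⟨hz, e⟩ := h z
    change φ _ = φ z + w at e
    rw [← e, Equiv.symm_apply_apply]
  · obtain ⟨t, ht, h⟩ := h2 _ (neg_mem_Lgrp n)
    refine ⟨t, ht, fun z => ?_⟩
    obtain ⟨hz, e⟩ := h z
    rw [Equiv.neg_apply] at e
    rw [← e, Equiv.symm_apply_apply]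
  · obtain ⟨l, hl, h⟩ := h1 g hg
    obtain ⟨w, hw⟩ := Lgrp_apply hl
    refine ⟨w, hw.imp (fun hw z => ?_) fun hw z => ?_⟩ <;>
    · obtain ⟨hz, e⟩ := h z
      rw [← hw, ← e, Equiv.symm_apply_apply]

theorem LocallyL.sq_smul (hloc : LocallyL n Γ G) {g : G} {u w z : α}
    (hu : g • u = u) (huw : Γ.Adj u w) (hw : g • w = w) (huz : Γ.Adj u z) : g ^ 2 • z = z := by
  obtain ⟨φ, -, -, h⟩ := hloc.exists_affine_action u
  rw [pow_two, mul_smul]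
  obtain ⟨a, h | h⟩ := h g hu
  · have ha : a = 0 := by
      have := h ⟨w, huw⟩
      have : (⟨w, huw⟩ : Γ.neighborSet u) = φ.symm (φ ⟨w, huw⟩ + a) :=
        Subtype.ext (hw.symm.trans this)
      simpa using congrArg φ this
    have hz : g • z = z := by simpa [ha] using h ⟨z, huz⟩
    rw [hz, hz]
  · rw [h ⟨z, huz⟩, h]
    simp

/-- An element of odd order fixing an edge is trivial. -/
theorem LocallyL.eq_one_of_coprime (hloc : LocallyL n Γ G) (hconn : Γ.Connected)
    (hfaith : ∀ g : G, (∀ u : α, g • u = u) → g = 1) {g : G} {u w : α}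
    (huw : Γ.Adj u w) (hu : g • u = u) (hw : g • w = w)
    (hg : Nat.Coprime 2 (orderOf g)) : g = 1 := by
  obtain ⟨m, hm⟩ := exists_pow_eq_self_of_coprime hg
  have key : ∀ {a b : α}, Γ.Adj a b → g • a = a → g • b = b → ∀ z, Γ.Adj a z → g • z = z := by
    intro a b hab ha hb z hz
    have : g ^ 2 ∈ stabilizer G z := hloc.sq_smul ha hab hb hz
    have := pow_mem this m
    rwa [hm] at this
  refine hfaith g fun v => (hconn.forall_of_adj
    (P := fun a => g • a = a ∧ ∀ z, Γ.Adj a z → g • z = z) ?_ ⟨hu, key huw hu hw⟩ v).1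
  rintro a b hab ⟨ha, hn⟩
  exact ⟨hn b hab, key hab.symm (hn b hab) ha⟩

theorem LocallyL.isPGroup_arc (hloc : LocallyL n Γ G) (hconn : Γ.Connected)
    (hfaith : ∀ g : G, (∀ u : α, g • u = u) → g = 1)
    (hfin : ∀ u : α, Finite (stabilizer G u)) {u w : α} (huw : Γ.Adj u w) :
    IsPGroup 2 (stabilizer G u ⊓ stabilizer G w : Subgroup G) := by
  rintro ⟨g, hu, hw⟩
  have : Finite (stabilizer G u) := hfin u
  have hpos : 0 < orderOf g := by
    have := orderOf_pos (⟨g, hu⟩ : stabilizer G u)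
    rwa [← Subgroup.orderOf_coe] at this
  obtain ⟨k, m, hm, hk⟩ := Nat.exists_eq_two_pow_mul_odd hpos.ne'
  refine ⟨k, Subtype.ext ?_⟩
  refine hloc.eq_one_of_coprime hconn hfaith huw (pow_mem hu _) (pow_mem hw _) ?_
  have hgm : (g ^ 2 ^ k) ^ m = 1 := by rw [← pow_mul, ← hk, pow_orderOf_eq_one]
  exact Nat.Coprime.coprime_dvd_right (orderOf_dvd_of_pow_eq_one hgm)
    (Nat.coprime_two_left.2 hm)

/-- The centre of the arc stabilizer `G_u ∩ G_w`. -/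
def arcCenter (G : Type*) [Group G] [MulAction G α] (u w : α) : Subgroup G :=
  (stabilizer G u ⊓ stabilizer G w) ⊓
    Subgroup.centralizer ((stabilizer G u ⊓ stabilizer G w : Subgroup G) : Set G)

theorem arcCenter_comm (u w : α) : arcCenter G u w = arcCenter G w u := by
  rw [arcCenter, arcCenter, inf_comm (stabilizer G u)]

theorem conj_mem_arcCenter {u w : α} {z : G} (hz : z ∈ arcCenter G u w) (k : G) :
    k * z * k⁻¹ ∈ arcCenter G (k • u) (k • w) := by
  obtain ⟨⟨hu, hw⟩, hc⟩ := hz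
  have hs : ∀ {a : α}, z ∈ stabilizer G a → k * z * k⁻¹ ∈ stabilizer G (k • a) := by
    intro a ha
    rw [mem_stabilizer_iff] at ha ⊢
    rw [mul_smul, inv_smul_smul, mul_smul, ha]
  refine ⟨⟨hs hu, hs hw⟩, fun g ⟨hgu, hgw⟩ => ?_⟩
  have hs' : ∀ {a : α}, g • k • a = k • a → (k⁻¹ * g * k) • a = a := by
    intro a ha
    rw [mul_smul, mul_smul, ha, inv_smul_smul]
  have := hc (k⁻¹ * g * k) ⟨hs' hgu, hs' hgw⟩
  calc g * (k * z * k⁻¹) = k * (k⁻¹ * g * k * z) * k⁻¹ := by group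
    _ = k * z * k⁻¹ * g := by rw [this]; group

theorem Zuw_le_arcCenter (u w : α) : Zuw G u w ≤ arcCenter G u w :=
  (Subgroup.closure_le _).2 fun _ h => h.1

/-- The arc stabilizer of a suitable arc at `u` has a central involution. -/
theorem LocallyL.exists_involution (hn : n ≠ 0) (hloc : LocallyL n Γ G) (hconn : Γ.Connected)
    (hfaith : ∀ g : G, (∀ u : α, g • u = u) → g = 1)
    (hfin : ∀ u : α, Finite (stabilizer G u)) (u : α) :
    ∃ w, Γ.Adj u w ∧ ∃ z ∈ arcCenter G u w, z ^ 2 = 1 ∧ z ≠ 1 := by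
  obtain ⟨φ, -, ⟨t, htu, ht⟩, -⟩ := hloc.exists_affine_action u
  have huw : Γ.Adj u (φ.symm 0) := (φ.symm 0).2
  refine ⟨φ.symm 0, huw, ?_⟩
  have hH := hloc.isPGroup_arc hconn hfaith hfin huw
  set H : Subgroup G := stabilizer G u ⊓ stabilizer G (φ.symm 0 : α) with hHdef
  have htw : t ∈ stabilizer G (φ.symm 0 : α) := by
    rw [mem_stabilizer_iff, ht]; simp
  have ht1 : t ≠ 1 := by
    rintro rfl
    have h := ht (φ.symm 1)
    rw [one_smul, Equiv.apply_symm_apply] at h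
    have h := congrFun (φ.symm.injective (Subtype.ext h)) ⟨0, Nat.pos_of_ne_zero hn⟩
    revert h
    simp only [Pi.one_apply, Pi.neg_apply]
    decide
  have : Finite (stabilizer G u) := hfin u
  have : Finite H := Finite.of_injective _ (Subgroup.inclusion_injective
    (inf_le_left : H ≤ stabilizer G u))
  have : Nontrivial H := ⟨⟨t, htu, htw⟩, 1, fun h => ht1 (congrArg Subtype.val h)⟩
  have : Nontrivial (Subgroup.center H) := hH.center_nontrivial
  have hcard : 2 ∣ Nat.card (Subgroup.center H) := by
    obtain ⟨k, hk, e⟩ := (hH.to_subgroup (Subgroup.center H)).nontrivial_iff_card.1 this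
    exact e ▸ dvd_pow_self 2 hk.ne'
  have : Fact (Nat.Prime 2) := ⟨Nat.prime_two⟩
  obtain ⟨z, hz⟩ := exists_prime_orderOf_dvd_card' 2 hcard
  have hz2 : (z : H) ^ 2 = 1 := by
    have := pow_orderOf_eq_one z
    rw [hz] at this
    exact_mod_cast congrArg Subtype.val this
  refine ⟨(z : H), ⟨(z : H).2, fun g hg => ?_⟩, congrArg Subtype.val hz2, fun h => ?_⟩
  · exact congrArg Subtype.val (Subgroup.mem_center_iff.1 z.2 ⟨g, hg⟩)
  · have : z = 1 := Subtype.ext (Subtype.ext h)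
    simp [this] at hz

theorem mem_Zsub_of_mem_arcCenter {u w : α} (huw : Γ.Adj u w) {z : G}
    (hz : z ∈ arcCenter G u w) (hz2 : z ^ 2 = 1) : z ∈ Zsub Γ G u :=
  Subgroup.subset_closure ⟨1, one_mem _, w, huw, z, Subgroup.subset_closure ⟨hz, hz2⟩, by simp⟩

theorem conj_mem_centralizer_Zsub {u : α} {t c : G} (ht : t ∈ stabilizer G u)
    (hc : c ∈ Subgroup.centralizer (Zsub Γ G u : Set G)) :
    t * c * t⁻¹ ∈ Subgroup.centralizer (Zsub Γ G u : Set G) := by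
  rw [Zsub, Subgroup.centralizer_closure] at hc ⊢
  rintro _ ⟨h, hh, w, hw, g, hg, rfl⟩
  have := hc (t⁻¹ * h * g * (t⁻¹ * h)⁻¹) ⟨_, mul_mem (inv_mem ht) hh, w, hw, g, hg, rfl⟩
  calc h * g * h⁻¹ * (t * c * t⁻¹) = t * (t⁻¹ * h * g * (t⁻¹ * h)⁻¹ * c) * t⁻¹ := by group
    _ = t * c * t⁻¹ * (h * g * h⁻¹) := by rw [this]; group

theorem ballStab_le_centralizer_Zsub (hconn : Γ.Connected)
    (haut : ∀ (g : G) (u w : α), Γ.Adj u w ↔ Γ.Adj (g • u) (g • w)) (u : α) :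
    ballStab Γ G u 1 ≤ stabilizer G u ⊓ Subgroup.centralizer (Zsub Γ G u : Set G) := by
  intro q hq
  rw [mem_ballStab_one hconn] at hq
  refine ⟨hq.1, ?_⟩
  rw [Zsub, Subgroup.centralizer_closure]
  rintro _ ⟨h, hh, w, hw, g, hg, rfl⟩
  have hg := conj_mem_arcCenter (Zuw_le_arcCenter u w hg) h
  rw [mem_stabilizer_iff.1 hh] at hg
  have hadj : Γ.Adj u (h • w) := by
    have := (haut h u w).1 hw
    rwa [mem_stabilizer_iff.1 hh] at this
  exact (hg.2 q ⟨hq.1, hq.2 _ hadj⟩).symm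

/-- `C_{G_u}(Z_u)` is not transitive on `Γ(u)`. -/
theorem centralizer_Zsub_not_transitive (hn : n ≠ 0) (hconn : Γ.Connected)
    (haut : ∀ (g : G) (u w : α), Γ.Adj u w ↔ Γ.Adj (g • u) (g • w))
    (hfaith : ∀ g : G, (∀ u : α, g • u = u) → g = 1)
    (harc : ∀ u w u' w' : α, Γ.Adj u w → Γ.Adj u' w' → ∃ g : G, g • u = u' ∧ g • w = w')
    (hfin : ∀ u : α, Finite (stabilizer G u)) (hloc : LocallyL n Γ G) (u : α) :
    ¬ ∀ z ∈ Γ.neighborSet u, ∀ w ∈ Γ.neighborSet u,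
        ∃ g ∈ stabilizer G u ⊓ Subgroup.centralizer ((Zsub Γ G u : Subgroup G) : Set G),
          g • z = w := by
  intro htrans
  have hu : ∀ {w w' : α} {z : G}, Γ.Adj u w → Γ.Adj u w' → z ∈ arcCenter G u w → z ^ 2 = 1 →
      z ∈ arcCenter G u w' := by
    intro w w' z hw hw' hz hz2
    obtain ⟨g, ⟨hgu, hgc⟩, rfl⟩ := htrans w hw w' hw'
    have := conj_mem_arcCenter hz g
    rwa [mem_stabilizer_iff.1 hgu, ← hgc z (mem_Zsub_of_mem_arcCenter hw hz hz2),
      mul_inv_cancel_right] at this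
  have hv : ∀ {v w w' : α} {z : G}, Γ.Adj v w → Γ.Adj v w' → z ∈ arcCenter G v w → z ^ 2 = 1 →
      z ∈ arcCenter G v w' := by
    intro v w w' z hw hw' hz hz2
    obtain ⟨b, hb⟩ := hloc.exists_adj u
    obtain ⟨k, hkv, -⟩ := harc v w u b hw hb
    have hz' := conj_mem_arcCenter hz k
    rw [haut k, hkv] at hw hw'
    rw [hkv] at hz'
    have := conj_mem_arcCenter (hu hw hw' hz' (by rw [conj_pow, hz2]; simp)) k⁻¹
    rw [← hkv, inv_smul_smul, inv_smul_smul] at this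
    convert this using 1
    group
  obtain ⟨w, huw, z, hz, hz2, hz1⟩ := hloc.exists_involution hn hconn hfaith hfin u
  refine hz1 (hfaith z fun v => ?_)
  obtain ⟨b, hb⟩ := hloc.exists_adj v
  exact (hconn.forall_of_adj (P := fun a => ∀ b, Γ.Adj a b → z ∈ arcCenter G a b)
    (fun a b hab ha c hbc => hv hab.symm hbc (arcCenter_comm (G := G) a b ▸ ha b hab) hz2)
    (fun b hb => hv huw hb hz hz2) v b hb).1.1

/-- If `C_{G_u}(Z_u)` is intransitive on `Γ(u)`, then its elements have cubes in `G_u^{[1]}`. -/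
theorem cube_mem_ballStab (hconn : Γ.Connected) (hloc : LocallyL n Γ G) {u : α}
    (hint : ¬ ∀ z ∈ Γ.neighborSet u, ∀ w ∈ Γ.neighborSet u,
        ∃ g ∈ stabilizer G u ⊓ Subgroup.centralizer ((Zsub Γ G u : Subgroup G) : Set G),
          g • z = w) {c : G}
    (hc : c ∈ stabilizer G u ⊓ Subgroup.centralizer ((Zsub Γ G u : Subgroup G) : Set G)) :
    c ^ 3 ∈ ballStab Γ G u 1 := by
  obtain ⟨φ, htr, -, h⟩ := hloc.exists_affine_action u
  rw [mem_ballStab_one hconn]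
  refine ⟨pow_mem hc.1 3, fun z hz => ?_⟩
  obtain ⟨a, h | h⟩ := h c hc.1
  · rw [pow_succ, pow_two, mul_smul, mul_smul, h ⟨z, hz⟩, h, h]
    simp only [Equiv.apply_symm_apply]
    rw [add_assoc, add_assoc, ← add_assoc a, Vec.add_add_self]
    simp
  · refine (hint fun p hp q hq => ?_).elim
    obtain ⟨t, htu, ht⟩ := htr (a - φ ⟨p, hp⟩ - φ ⟨q, hq⟩)
    refine ⟨t * c * t⁻¹, ⟨(stabilizer G u).mul_mem (mul_mem htu hc.1) (inv_mem htu),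
      conj_mem_centralizer_Zsub htu hc.2⟩, ?_⟩
    have hinv : t⁻¹ • p = φ.symm (φ ⟨p, hp⟩ - (a - φ ⟨p, hp⟩ - φ ⟨q, hq⟩)) := by
      rw [inv_smul_eq_iff, ht]
      simp
    rw [mul_smul, mul_smul, hinv, h, ht]
    simp only [Equiv.apply_symm_apply]
    have : -(φ ⟨p, hp⟩ - (a - φ ⟨p, hp⟩ - φ ⟨q, hq⟩)) + a + (a - φ ⟨p, hp⟩ - φ ⟨q, hq⟩) =
        (a + a + a) - (φ ⟨p, hp⟩ + φ ⟨p, hp⟩ + φ ⟨p, hp⟩) -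
          (φ ⟨q, hq⟩ + φ ⟨q, hq⟩ + φ ⟨q, hq⟩) + φ ⟨q, hq⟩ := by abel
    rw [this, Vec.add_add_self, Vec.add_add_self, Vec.add_add_self]
    simp

end Local

/-- for every vertex `u`, `C_{G_u}(Z_u)` is not transitive on `Γ(u)` and
`Q_u` is a Sylow 2-subgroup of `C_{G_u}(Z_u)`. -/
theorem centralizer_Zsub_intransitive_and_Q_sylow
    {α : Type*} (n : ℕ) (hn : 2 ≤ n) (Γ : SimpleGraph α)
    (G : Type*) [Group G] [MulAction G α]
    (hconn : Γ.Connected) (hacyc : Γ.IsAcyclic)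
    (haut : ∀ (g : G) (u w : α), Γ.Adj u w ↔ Γ.Adj (g • u) (g • w))
    (hfaith : ∀ g : G, (∀ u : α, g • u = u) → g = 1)
    (harc : ∀ u w u' w' : α, Γ.Adj u w → Γ.Adj u' w' → ∃ g : G, g • u = u' ∧ g • w = w')
    (hfin : ∀ u : α, Finite (stabilizer G u))
    (hloc : LocallyL n Γ G)
    (x y : α) (hxy : Γ.Adj x y)
    (hntriv : ballStab Γ G x 1 ⊓ ballStab Γ G y 1 ≠ ⊥)
 :
    ∀ u : α,
      (¬ ∀ z ∈ Γ.neighborSet u, ∀ w ∈ Γ.neighborSet u,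
        ∃ g ∈ stabilizer G u ⊓ Subgroup.centralizer ((Zsub Γ G u : Subgroup G) : Set G),
          g • z = w) ∧
      ballStab Γ G u 1 ≤
        stabilizer G u ⊓ Subgroup.centralizer ((Zsub Γ G u : Subgroup G) : Set G) ∧
      ∃ P : Sylow 2 ↥(stabilizer G u ⊓
          Subgroup.centralizer ((Zsub Γ G u : Subgroup G) : Set G)),
        (P : Subgroup ↥(stabilizer G u ⊓
          Subgroup.centralizer ((Zsub Γ G u : Subgroup G) : Set G))) =
          (ballStab Γ G u 1).subgroupOf (stabilizer G u ⊓
            Subgroup.centralizer ((Zsub Γ G u : Subgroup G) : Set G)) := by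
  intro u
  have hint := centralizer_Zsub_not_transitive (by omega) hconn haut hfaith harc hfin hloc u
  refine ⟨hint, ballStab_le_centralizer_Zsub hconn haut u, ?_⟩
  obtain ⟨w, huw⟩ := hloc.exists_adj u
  have hQ : IsPGroup 2 (ballStab Γ G u 1) :=
    (hloc.isPGroup_arc hconn hfaith hfin huw).to_le fun q hq => by
      rw [mem_ballStab_one hconn] at hq
      exact ⟨hq.1, hq.2 w huw⟩
  refine ⟨⟨_, hQ.comap_subtype, fun {R} hR hle => le_antisymm (fun c hc => ?_) hle⟩, rfl⟩
  obtain ⟨k, hk⟩ := hR ⟨c, hc⟩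
  have hk : (c : G) ^ 2 ^ k = 1 := congrArg (fun r : R => ((r : _) : G)) hk
  have hcop : Nat.Coprime 3 (orderOf (c : G)) :=
    Nat.Coprime.coprime_dvd_right (orderOf_dvd_of_pow_eq_one hk)
      (Nat.Coprime.pow_right k (by decide))
  obtain ⟨m, hm⟩ := exists_pow_eq_self_of_coprime hcop
  change (c : G) ∈ ballStab Γ G u 1
  rw [← hm]
  exact pow_mem (cube_mem_ballStab hconn hloc hint c.2) m
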